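/- For every b ∈ PC(Γ), any solution m̂ of the stationary Fokker–Planck problem on Γ associated with b is strictly positive: m̂_α(y) > 0 for every α ∈ 𝒜 and every y ∈ [0, ℓ_α]. -/

import Mathlib

open Set

/-- A connected network: finite vertex set `I`, finite edge set `A`, each edge `α`
identified with `[0, ℓ α]`, with endpoint `0` attached to `src α` and endpoint `ℓ α`
attached to `tgt α`, these being distinct vertices; the resulting graph is connected. -/
structure Network (I A : Type) [Fintype I] [Fintype A] [DecidableEq I] where
  ℓ : A → ℝ
  ℓ_pos : ∀ α, 0 < ℓ α
  src : A → I
  tgt : A → I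
  src_ne_tgt : ∀ α, src α ≠ tgt α
  connected : ∀ i j : I,
    Relation.ReflTransGen
      (fun i j => ∃ α, (src α = i ∧ tgt α = j) ∨ (src α = j ∧ tgt α = i)) i j

namespace Network

variable {I A : Type} [Fintype I] [Fintype A] [DecidableEq I]

/-- The set `𝒜_i` of edges incident to the vertex `i`. -/
def edges (N : Network I A) (i : I) : Finset A :=
  Finset.univ.filter fun α => N.src α = i ∨ N.tgt α = i

/-- The value `f|_α(ν_i)` of an edgewise family `f` at the vertex `i` along the edge `α`. -/
def vval (N : Network I A) (f : A → ℝ → ℝ) (i : I) (α : A) : ℝ :=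
  if N.src α = i then f α 0 else f α (N.ℓ α)

/-- The outward directional derivative `∂_α f(ν_i)`, expressed via the family `f'` of
edgewise first derivatives. -/
def oderiv (N : Network I A) (f' : A → ℝ → ℝ) (i : I) (α : A) : ℝ :=
  if N.src α = i then -(f' α 0) else f' α (N.ℓ α)

/-- The sign `n_{iα}`: `-1` if `ν_i` is attached to the endpoint `0` of `α`, `+1` if it is
attached to the endpoint `ℓ α`. -/
def sgn (N : Network I A) (i : I) (α : A) : ℝ :=
  if N.src α = i then -1 else 1

/-- `v = (v_α)` is a `C²` function on the network, with first derivatives `v'` and second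
derivatives `v''`, continuous at the vertices. -/
def IsC2 (N : Network I A) (v v' v'' : A → ℝ → ℝ) : Prop :=
  (∀ α, ∀ y ∈ Icc (0:ℝ) (N.ℓ α), HasDerivWithinAt (v α) (v' α y) (Icc 0 (N.ℓ α)) y) ∧
  (∀ α, ∀ y ∈ Icc (0:ℝ) (N.ℓ α), HasDerivWithinAt (v' α) (v'' α y) (Icc 0 (N.ℓ α)) y) ∧
  (∀ α, ContinuousOn (v'' α) (Icc 0 (N.ℓ α))) ∧
  (∀ i : I, ∀ α ∈ N.edges i, ∀ β ∈ N.edges i, N.vval v i α = N.vval v i β)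

/-- The Kirchhoff conditions `∑_{α ∈ 𝒜_i} γ_{iα} μ_α ∂_α v(ν_i) = 0` at every vertex. -/
def Kirchhoff (N : Network I A) (μ : A → ℝ) (γ : I → A → ℝ) (v' : A → ℝ → ℝ) : Prop :=
  ∀ i : I, ∑ α ∈ N.edges i, γ i α * μ α * N.oderiv v' i α = 0

end Network

namespace Network

variable {I A : Type} [Fintype I] [Fintype A] [DecidableEq I]

/-- A solution of the stationary Fokker–Planck problem on the network associated with the
drift `b`: `m` (with edgewise derivative `m'`) is `C¹` on each edge, satisfies the jump
conditions `m|_α(ν_i)/γ_{iα} = m|_β(ν_i)/γ_{iβ}`, the first integral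
`μ_α m_α' + b_α m_α = c_α` on each edge, the vertex transmission conditions
`∑_{α ∈ 𝒜_i} [n_{iα} b|_α(ν_i) m|_α(ν_i) + μ_α ∂_α m(ν_i)] = 0`, is nonnegative and has
total integral `1`. -/
def IsFPSolution (N : Network I A) (μ : A → ℝ) (γ : I → A → ℝ)
    (b : A → ℝ → ℝ) (m m' : A → ℝ → ℝ) : Prop :=
  (∀ α, ∀ y ∈ Icc (0:ℝ) (N.ℓ α), HasDerivWithinAt (m α) (m' α y) (Icc 0 (N.ℓ α)) y) ∧
  (∀ α, ContinuousOn (m' α) (Icc 0 (N.ℓ α))) ∧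
  (∀ i : I, ∀ α ∈ N.edges i, ∀ β ∈ N.edges i,
      N.vval m i α / γ i α = N.vval m i β / γ i β) ∧
  (∀ α, ∃ c : ℝ, ∀ y ∈ Icc (0:ℝ) (N.ℓ α), μ α * m' α y + b α y * m α y = c) ∧
  (∀ i : I, ∑ α ∈ N.edges i,
      (N.sgn i α * N.vval b i α * N.vval m i α + μ α * N.oderiv m' i α) = 0) ∧
  (∀ α, ∀ y ∈ Icc (0:ℝ) (N.ℓ α), 0 ≤ m α y) ∧
  (∑ α : A, ∫ y in (0:ℝ)..(N.ℓ α), m α y) = 1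

/-- The standing assumptions on the Hamiltonians `H_α : [0, ℓ_α] × ℝ → ℝ` with partial
derivatives `Hp_α = ∂_p H_α`: `C¹` regularity, convexity in `p`, coercivity
`H_α(x,p) ≥ C₀|p|^q − C₁` and the growth condition `|∂_p H_α(x,p)| ≤ C₂(|p|^{q−1} + 1)`. -/
def HamHyp (N : Network I A) (H Hp : A → ℝ → ℝ → ℝ) (q C0 C1 C2 : ℝ) : Prop :=
  (∀ α, ContDiffOn ℝ 1 (fun z : ℝ × ℝ => H α z.1 z.2)
      (Icc (0:ℝ) (N.ℓ α) ×ˢ (univ : Set ℝ))) ∧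
  (∀ α, ∀ x ∈ Icc (0:ℝ) (N.ℓ α), ∀ p : ℝ, HasDerivAt (fun p => H α x p) (Hp α x p) p) ∧
  (∀ α, ∀ x ∈ Icc (0:ℝ) (N.ℓ α), ConvexOn ℝ univ (fun p => H α x p)) ∧
  (∀ α, ∀ x ∈ Icc (0:ℝ) (N.ℓ α), ∀ p : ℝ, C0 * |p| ^ q - C1 ≤ H α x p) ∧
  (∀ α, ∀ x ∈ Icc (0:ℝ) (N.ℓ α), ∀ p : ℝ, |Hp α x p| ≤ C2 * (|p| ^ (q - 1) + 1))

/-- A solution `(v, m, ρ)` of the stationary MFG system on the network: `v` is `C²`,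
solves the ergodic HJB equation with coupling `F(m)` and the Kirchhoff conditions; `m` is
`C¹` on each edge, satisfies the jump conditions, the first-integral form of the
Fokker–Planck equation `μ_α m_α' + m_α ∂_p H_α(·, v_α') = c_α` with `∑_{α∈𝒜_i} n_{iα} c_α = 0`
at every vertex, `m ≥ 0`, `∫_Γ m = 1` and `∫_Γ v = 0`. -/
def IsMFGSolution (N : Network I A) (μ : A → ℝ) (γ : I → A → ℝ)
    (H Hp : A → ℝ → ℝ → ℝ) (F : ℝ → ℝ)
    (v v' v'' m m' : A → ℝ → ℝ) (ρ : ℝ) : Prop :=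
  IsC2 N v v' v'' ∧
  (∀ α, ∀ y ∈ Ioo (0:ℝ) (N.ℓ α),
      -(μ α * v'' α y) + H α y (v' α y) + ρ = F (m α y)) ∧
  Kirchhoff N μ γ v' ∧
  (∀ α, ∀ y ∈ Icc (0:ℝ) (N.ℓ α), HasDerivWithinAt (m α) (m' α y) (Icc 0 (N.ℓ α)) y) ∧
  (∀ α, ContinuousOn (m' α) (Icc 0 (N.ℓ α))) ∧
  (∀ i : I, ∀ α ∈ N.edges i, ∀ β ∈ N.edges i,
      N.vval m i α / γ i α = N.vval m i β / γ i β) ∧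
  (∃ c : A → ℝ,
    (∀ α, ∀ y ∈ Icc (0:ℝ) (N.ℓ α), μ α * m' α y + m α y * Hp α y (v' α y) = c α) ∧
    (∀ i : I, ∑ α ∈ N.edges i, N.sgn i α * c α = 0)) ∧
  (∀ α, ∀ y ∈ Icc (0:ℝ) (N.ℓ α), 0 ≤ m α y) ∧
  (∑ α : A, ∫ y in (0:ℝ)..(N.ℓ α), m α y) = 1 ∧
  (∑ α : A, ∫ y in (0:ℝ)..(N.ℓ α), v α y) = 0

end Network

namespace Network

/-- A positive integrating factor `E` on `[0, l]`, with `E' = a * E`, for continuous `a`. -/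
theorem exists_integratingFactor {l : ℝ} (hl : 0 < l) {a : ℝ → ℝ}
    (ha : ContinuousOn a (Icc 0 l)) :
    ∃ E : ℝ → ℝ, (∀ y, 0 < E y) ∧
      ∀ y ∈ Icc (0 : ℝ) l, HasDerivWithinAt E (a y * E y) (Icc 0 l) y := by
  have hg : Continuous (IccExtend hl.le ((Icc 0 l).domRestrict a)) :=
    ha.domRestrict.Icc_extend'
  refine ⟨fun y => Real.exp (∫ t in (0 : ℝ)..y, IccExtend hl.le ((Icc 0 l).domRestrict a) t),
    fun y => Real.exp_pos _, fun y hy => ?_⟩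
  have h := (hg.integral_hasStrictDerivAt 0 y).hasDerivAt.exp.hasDerivWithinAt (s := Icc 0 l)
  rw [IccExtend_of_mem hl.le _ hy, mul_comm] at h
  exact h

section FirstIntegral

variable {l k c : ℝ} {b f f' : ℝ → ℝ}

/-- A solution of `k f' + b f = c`, times a suitable positive factor, is monotone or antitone
according to the sign of `c`. -/
theorem exists_factor_monotoneOn (hl : 0 < l) (hk : 0 < k) (hb : ContinuousOn b (Icc 0 l))
    (hf : ∀ y ∈ Icc (0 : ℝ) l, HasDerivWithinAt f (f' y) (Icc 0 l) y)
    (hc : ∀ y ∈ Icc (0 : ℝ) l, k * f' y + b y * f y = c) :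
    ∃ E : ℝ → ℝ, (∀ y, 0 < E y) ∧ (0 ≤ c → MonotoneOn (fun y => f y * E y) (Icc 0 l)) ∧
      (c ≤ 0 → AntitoneOn (fun y => f y * E y) (Icc 0 l)) := by
  obtain ⟨E, hE, hE'⟩ := exists_integratingFactor hl (hb.div_const k)
  have hder : ∀ y ∈ Icc (0 : ℝ) l,
      HasDerivWithinAt (fun y => f y * E y) (c / k * E y) (Icc 0 l) y := by
    intro y hy
    refine ((hf y hy).mul (hE' y hy)).congr_deriv ?_
    rw [← hc y hy]
    field_simp
  have hcont : ContinuousOn (fun y => f y * E y) (Icc 0 l) :=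
    fun y hy => (hder y hy).continuousWithinAt
  have hint : ∀ y ∈ interior (Icc (0 : ℝ) l),
      HasDerivWithinAt (fun y => f y * E y) (c / k * E y) (interior (Icc 0 l)) y :=
    fun y hy => (hder y (interior_subset hy)).mono interior_subset
  refine ⟨E, hE, fun h => ?_, fun h => ?_⟩
  · exact monotoneOn_of_hasDerivWithinAt_nonneg (convex_Icc 0 l) hcont hint
      fun y _ => mul_nonneg (div_nonneg h hk.le) (hE y).le
  · exact antitoneOn_of_hasDerivWithinAt_nonpos (convex_Icc 0 l) hcont hint
      fun y _ => mul_nonpos_of_nonpos_of_nonneg (div_nonpos_of_nonpos_of_nonneg h hk.le) (hE y).le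

theorem eq_zero_of_left (hl : 0 < l) (hk : 0 < k) (hb : ContinuousOn b (Icc 0 l))
    (hf : ∀ y ∈ Icc (0 : ℝ) l, HasDerivWithinAt f (f' y) (Icc 0 l) y)
    (hc : ∀ y ∈ Icc (0 : ℝ) l, k * f' y + b y * f y = c)
    (hf0 : ∀ y ∈ Icc (0 : ℝ) l, 0 ≤ f y) (h0 : f 0 = 0) (h0' : f' 0 ≤ 0) :
    ∀ y ∈ Icc (0 : ℝ) l, f y = 0 := by
  obtain ⟨E, hE, -, hanti⟩ := exists_factor_monotoneOn hl hk hb hf hc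
  have h0m : (0 : ℝ) ∈ Icc (0 : ℝ) l := left_mem_Icc.2 hl.le
  have hc0 : c ≤ 0 := by
    rw [← hc 0 h0m, h0, mul_zero, add_zero]
    exact mul_nonpos_of_nonneg_of_nonpos hk.le h0'
  intro y hy
  have h : f y * E y ≤ f 0 * E 0 := hanti hc0 h0m hy hy.1
  rw [h0, zero_mul] at h
  exact le_antisymm (nonpos_of_mul_nonpos_left h (hE y)) (hf0 y hy)

theorem eq_zero_of_right (hl : 0 < l) (hk : 0 < k) (hb : ContinuousOn b (Icc 0 l))
    (hf : ∀ y ∈ Icc (0 : ℝ) l, HasDerivWithinAt f (f' y) (Icc 0 l) y)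
    (hc : ∀ y ∈ Icc (0 : ℝ) l, k * f' y + b y * f y = c)
    (hf0 : ∀ y ∈ Icc (0 : ℝ) l, 0 ≤ f y) (h0 : f l = 0) (h0' : 0 ≤ f' l) :
    ∀ y ∈ Icc (0 : ℝ) l, f y = 0 := by
  obtain ⟨E, hE, hmono, -⟩ := exists_factor_monotoneOn hl hk hb hf hc
  have hlm : l ∈ Icc (0 : ℝ) l := right_mem_Icc.2 hl.le
  have hc0 : 0 ≤ c := by
    rw [← hc l hlm, h0, mul_zero, add_zero]
    exact mul_nonneg hk.le h0'
  intro y hy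
  have h : f y * E y ≤ f l * E l := hmono hc0 hy hlm hy.2
  rw [h0, zero_mul] at h
  exact le_antisymm (nonpos_of_mul_nonpos_left h (hE y)) (hf0 y hy)

/-- A nonnegative solution vanishing somewhere vanishes at an endpoint. -/
theorem endpoint_eq_zero (hl : 0 < l) (hk : 0 < k) (hb : ContinuousOn b (Icc 0 l))
    (hf : ∀ y ∈ Icc (0 : ℝ) l, HasDerivWithinAt f (f' y) (Icc 0 l) y)
    (hc : ∀ y ∈ Icc (0 : ℝ) l, k * f' y + b y * f y = c)
    (hf0 : ∀ y ∈ Icc (0 : ℝ) l, 0 ≤ f y) {y : ℝ} (hy : y ∈ Icc (0 : ℝ) l) (hfy : f y = 0) :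
    f 0 = 0 ∨ f l = 0 := by
  obtain ⟨E, hE, hmono, hanti⟩ := exists_factor_monotoneOn hl hk hb hf hc
  have h0m : (0 : ℝ) ∈ Icc (0 : ℝ) l := left_mem_Icc.2 hl.le
  have hlm : l ∈ Icc (0 : ℝ) l := right_mem_Icc.2 hl.le
  rcases le_total 0 c with h | h
  · left
    have h' : f 0 * E 0 ≤ f y * E y := hmono h h0m hy hy.1
    rw [hfy, zero_mul] at h'
    exact le_antisymm (nonpos_of_mul_nonpos_left h' (hE 0)) (hf0 0 h0m)
  · right
    have h' : f l * E l ≤ f y * E y := hanti h hy hlm hy.2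
    rw [hfy, zero_mul] at h'
    exact le_antisymm (nonpos_of_mul_nonpos_left h' (hE l)) (hf0 l hlm)

theorem deriv_eq_zero_of_eqOn_zero (hl : 0 < l)
    (hf : ∀ y ∈ Icc (0 : ℝ) l, HasDerivWithinAt f (f' y) (Icc 0 l) y)
    (h : ∀ y ∈ Icc (0 : ℝ) l, f y = 0) {y : ℝ} (hy : y ∈ Icc (0 : ℝ) l) : f' y = 0 :=
  (uniqueDiffOn_Icc hl y hy).eq_deriv _ (hf y hy)
    ((hasDerivWithinAt_const y (Icc 0 l) (0 : ℝ)).congr h (h y hy))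

end FirstIntegral

section Solution

variable {I A : Type} [Fintype I] [Fintype A] [DecidableEq I] {N : Network I A}
  {μ : A → ℝ} {γ : I → A → ℝ} {b m m' : A → ℝ → ℝ}

theorem mem_edges {i : I} {α : A} : α ∈ N.edges i ↔ N.src α = i ∨ N.tgt α = i := by
  simp [edges]

/-- If a solution vanishes at a vertex along an incident edge and its outward derivative there is
nonnegative, then it vanishes on the edge. -/
theorem IsFPSolution.eq_zero_of_oderiv_nonneg (hm : IsFPSolution N μ γ b m m')
    (hμ : ∀ α, 0 < μ α) (hb : ∀ α, ContinuousOn (b α) (Icc (0 : ℝ) (N.ℓ α)))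
    {i : I} {α : A} (h : N.vval m i α = 0) (h' : 0 ≤ N.oderiv m' i α) :
    ∀ y ∈ Icc (0 : ℝ) (N.ℓ α), m α y = 0 := by
  obtain ⟨hder, -, -, hc, -, hnn, -⟩ := hm
  obtain ⟨c, hc⟩ := hc α
  by_cases hi : N.src α = i
  · simp only [vval, oderiv, hi, if_true] at h h'
    exact eq_zero_of_left (N.ℓ_pos α) (hμ α) (hb α) (hder α) hc (hnn α) h (by linarith)
  · simp only [vval, oderiv, hi, if_false] at h h'
    exact eq_zero_of_right (N.ℓ_pos α) (hμ α) (hb α) (hder α) hc (hnn α) h h'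

theorem IsFPSolution.oderiv_nonpos (hm : IsFPSolution N μ γ b m m')
    (hμ : ∀ α, 0 < μ α) (hb : ∀ α, ContinuousOn (b α) (Icc (0 : ℝ) (N.ℓ α)))
    {i : I} {α : A} (h : N.vval m i α = 0) : N.oderiv m' i α ≤ 0 := by
  by_contra! hpos
  have hz := hm.eq_zero_of_oderiv_nonneg hμ hb h hpos.le
  have hd {y : ℝ} (hy : y ∈ Icc (0 : ℝ) (N.ℓ α)) : m' α y = 0 :=
    deriv_eq_zero_of_eqOn_zero (N.ℓ_pos α) (hm.1 α) hz hy
  rw [oderiv, hd (left_mem_Icc.2 (N.ℓ_pos α).le), hd (right_mem_Icc.2 (N.ℓ_pos α).le)] at hpos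
  simp at hpos

/-- If a solution vanishes at a vertex along all incident edges, it vanishes on these edges. -/
theorem IsFPSolution.eq_zero_of_vertex (hm : IsFPSolution N μ γ b m m')
    (hμ : ∀ α, 0 < μ α) (hb : ∀ α, ContinuousOn (b α) (Icc (0 : ℝ) (N.ℓ α)))
    {i : I} (h : ∀ α ∈ N.edges i, N.vval m i α = 0) {α : A} (hα : α ∈ N.edges i) :
    ∀ y ∈ Icc (0 : ℝ) (N.ℓ α), m α y = 0 := by
  have hsum : ∑ α ∈ N.edges i, μ α * N.oderiv m' i α = 0 := by
    rw [← hm.2.2.2.2.1 i]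
    exact Finset.sum_congr rfl fun β hβ => by rw [h β hβ, mul_zero, zero_add]
  rw [Finset.sum_eq_zero_iff_of_nonpos fun β hβ =>
    mul_nonpos_of_nonneg_of_nonpos (hμ β).le (hm.oderiv_nonpos hμ hb (h β hβ))] at hsum
  exact hm.eq_zero_of_oderiv_nonneg hμ hb (h α hα)
    ((mul_eq_zero.1 (hsum α hα)).resolve_left (hμ α).ne').ge

/-- By the jump conditions, vanishing at a vertex along one edge propagates to all edges there. -/
theorem IsFPSolution.vval_eq_zero (hm : IsFPSolution N μ γ b m m')
    (hγ : ∀ i : I, ∀ α ∈ N.edges i, 0 < γ i α) {i : I} {α : A} (hα : α ∈ N.edges i)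
    (h : N.vval m i α = 0) : ∀ β ∈ N.edges i, N.vval m i β = 0 := by
  intro β hβ
  have hj := hm.2.2.1 i α hα β hβ
  rw [h, zero_div] at hj
  exact (div_eq_zero_iff.1 hj.symm).resolve_right (hγ i β hβ).ne'

theorem IsFPSolution.vval_eq_zero_of_adj (hm : IsFPSolution N μ γ b m m')
    (hμ : ∀ α, 0 < μ α) (hγ : ∀ i : I, ∀ α ∈ N.edges i, 0 < γ i α)
    (hb : ∀ α, ContinuousOn (b α) (Icc (0 : ℝ) (N.ℓ α))) {i j : I} {α : A}
    (hi : α ∈ N.edges i) (hj : α ∈ N.edges j) (h : ∀ β ∈ N.edges i, N.vval m i β = 0) :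
    ∀ β ∈ N.edges j, N.vval m j β = 0 := by
  have hz := hm.eq_zero_of_vertex hμ hb h hi
  refine hm.vval_eq_zero hγ hj ?_
  rw [vval, hz 0 (left_mem_Icc.2 (N.ℓ_pos α).le), hz _ (right_mem_Icc.2 (N.ℓ_pos α).le), ite_self]

end Solution

end Network

/-- any solution of the stationary Fokker–Planck problem is strictly
positive on the whole network. -/
theorem stmt_6 {I A : Type} [Fintype I] [Fintype A] [DecidableEq I]
    (N : Network I A) (μ : A → ℝ) (γ : I → A → ℝ)
    (hμ : ∀ α, 0 < μ α) (hγ : ∀ i : I, ∀ α ∈ N.edges i, 0 < γ i α)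
    (b : A → ℝ → ℝ) (hb : ∀ α, ContinuousOn (b α) (Icc (0:ℝ) (N.ℓ α)))
    (m m' : A → ℝ → ℝ) (hm : Network.IsFPSolution N μ γ b m m') :
    ∀ α : A, ∀ y ∈ Icc (0:ℝ) (N.ℓ α), 0 < m α y := by
  intro α y hy
  by_contra hneg
  have hy0 : m α y = 0 := le_antisymm (not_lt.1 hneg) (hm.2.2.2.2.2.1 α y hy)
  obtain ⟨c, hc⟩ := hm.2.2.2.1 α
  have hvertex : ∃ i, ∀ β ∈ N.edges i, N.vval m i β = 0 := by
    rcases Network.endpoint_eq_zero (N.ℓ_pos α) (hμ α) (hb α) (hm.1 α) hc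
      (hm.2.2.2.2.2.1 α) hy hy0 with h | h
    · exact ⟨N.src α, hm.vval_eq_zero hγ (Network.mem_edges.2 (Or.inl rfl))
        (by simpa [Network.vval] using h)⟩
    · exact ⟨N.tgt α, hm.vval_eq_zero hγ (Network.mem_edges.2 (Or.inr rfl))
        (by simpa [Network.vval, N.src_ne_tgt α] using h)⟩
  obtain ⟨i, hi⟩ := hvertex
  have hall : ∀ j, ∀ β ∈ N.edges j, N.vval m j β = 0 := by
    intro j
    induction N.connected i j with
    | refl => exact hi
    | tail _ hadj ih =>
      obtain ⟨β, ⟨h₁, h₂⟩ | ⟨h₁, h₂⟩⟩ := hadj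
      · exact hm.vval_eq_zero_of_adj hμ hγ hb (Network.mem_edges.2 (Or.inl h₁))
          (Network.mem_edges.2 (Or.inr h₂)) ih
      · exact hm.vval_eq_zero_of_adj hμ hγ hb (Network.mem_edges.2 (Or.inr h₂))
          (Network.mem_edges.2 (Or.inl h₁)) ih
  have hint : ∑ β : A, ∫ y in (0 : ℝ)..(N.ℓ β), m β y = 0 := by
    refine Finset.sum_eq_zero fun β _ => intervalIntegral.integral_zero_ae (.of_forall ?_)
    intro x hx
    rw [uIoc_of_le (N.ℓ_pos β).le] at hx
    exact hm.eq_zero_of_vertex hμ hb (hall (N.src β)) (Network.mem_edges.2 (Or.inl rfl)) x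
      (Ioc_subset_Icc_self hx)
  exact zero_ne_one (hint.symm.trans hm.2.2.2.2.2.2)
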